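/- arXiv:1512.02266 — 12 statements merged into one kernel-verified Lean document; each statement's English description precedes it below -/
import Mathlib

section
/- In the multilinear single full CPT setting with target set T ⊆ 𝕐 and A_{j,s} = Σ_{y∈T : s∈S(y)} ∏_{l∈S(y)∖{s}} θ_l, suppose the varied vector θ̃ is obtained by setting θ̃_{j_i} = x_j and θ̃_s = γ_s x_j + δ_s for s ∈ Θ_j∖{j_i} (a linear covariation scheme with reals γ_s, δ_s), leaving θ unchanged outside the blocks. Then the sensitivity function satisfies Σ_{y∈T} p_{θ̃}(y) = Σ_{j=1}^n a_j x_j + b, where a_j = A_{j,j_i} + Σ_{s∈Θ_j∖{j_i}} γ_s A_{j,s} and b = Σ_{j=1}^n Σ_{s∈Θ_j∖{j_i}} δ_s A_{j,s} + Σ_{y∈T : S(y)∩⋃_j Θ_j = ∅} ∏_{l∈S(y)} θ_l; in particular the sensitivity function is affine (multilinear) in the varied parameters x_1,…,x_n. -/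
/-- If `s` meets `U` in at most one point and `g` agrees with `f` off `U`, then the product of `g`
over `s` is obtained from that of `f` by replacing the factor at the point of `s ∩ U`, if any. -/
theorem Finset.prod_eq_sum_inter_add_ite {ι R : Type*} [DecidableEq ι] [CommSemiring R]
    {s U : Finset ι} {f g : ι → R} (hcard : (s ∩ U).card ≤ 1) (hfg : ∀ i, i ∉ U → g i = f i) :
    ∏ l ∈ s, g l =
      ∑ i ∈ s ∩ U, g i * ∏ l ∈ s.erase i, f l + if s ∩ U = ∅ then ∏ l ∈ s, f l else 0 := by
  rcases Finset.eq_empty_or_nonempty (s ∩ U) with h | h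
  · rw [h, if_pos rfl, Finset.sum_empty, zero_add]
    exact Finset.prod_congr rfl fun i hi => hfg i fun hU =>
      Finset.notMem_empty i (h ▸ Finset.mem_inter.2 ⟨hi, hU⟩)
  · obtain ⟨a, ha⟩ := Finset.card_eq_one.1 (le_antisymm hcard h.card_pos)
    have has : a ∈ s := (Finset.mem_inter.1 (ha ▸ Finset.mem_singleton_self a)).1
    rw [if_neg h.ne_empty, ha, Finset.sum_singleton, add_zero, ← Finset.mul_prod_erase s g has]
    congr 1
    refine Finset.prod_congr rfl fun i hi => hfg i fun hU => Finset.ne_of_mem_erase hi ?_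
    exact Finset.mem_singleton.1 (ha ▸ Finset.mem_inter.2 ⟨Finset.mem_of_mem_erase hi, hU⟩)

/-- **Multilinearity of the sensitivity function under a linear covariation scheme.**
In the multilinear single full CPT setting, if `θt` is obtained by varying each
distinguished parameter `θ (ji j)` to `x j` and covarying `θ s`, `s ∈ Θ j \ {ji j}`,
linearly to `γ s * x j + δ s`, then the sensitivity function is affine in `x₁,…,xₙ`,
with the stated coefficients. -/
theorem stmt_1 {Y : Type} [Fintype Y] [Nonempty Y] {k n : ℕ}
    (S : Y → Finset (Fin k)) (Θ : Fin n → Finset (Fin k))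
    (hdisj : ∀ j j' : Fin n, j ≠ j' → Disjoint (Θ j) (Θ j'))
    (ji : Fin n → Fin k) (hji : ∀ j, ji j ∈ Θ j)
    (hcard : ∀ y : Y, (S y ∩ Finset.univ.biUnion Θ).card ≤ 1)
    (θ : Fin k → ℝ) (hθ : ∀ i, 0 < θ i)
    (γ δ : Fin k → ℝ) (x : Fin n → ℝ) (θt : Fin k → ℝ)
    (hvar : ∀ j, θt (ji j) = x j)
    (hcov : ∀ j, ∀ s ∈ (Θ j).erase (ji j), θt s = γ s * x j + δ s)
    (hagree : ∀ i, i ∉ Finset.univ.biUnion Θ → θt i = θ i)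
    (T : Finset Y) (A : Fin n → Fin k → ℝ)
    (hA : ∀ j s, A j s =
      ∑ y ∈ T.filter (fun y => s ∈ S y), ∏ l ∈ (S y).erase s, θ l) :
    ∑ y ∈ T, ∏ l ∈ S y, θt l =
      (∑ j, (A j (ji j) + ∑ s ∈ (Θ j).erase (ji j), γ s * A j s) * x j) +
      ((∑ j, ∑ s ∈ (Θ j).erase (ji j), δ s * A j s) +
        ∑ y ∈ T.filter (fun y => S y ∩ Finset.univ.biUnion Θ = ∅),
          ∏ l ∈ S y, θ l) := by
  have block : ∀ j, (A j (ji j) + ∑ s ∈ (Θ j).erase (ji j), γ s * A j s) * x j +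
      ∑ s ∈ (Θ j).erase (ji j), δ s * A j s = ∑ s ∈ Θ j, θt s * A j s := by
    intro j
    rw [← Finset.add_sum_erase _ _ (hji j), hvar, add_mul, add_assoc, Finset.sum_mul,
      ← Finset.sum_add_distrib, mul_comm]
    congr 1
    refine Finset.sum_congr rfl fun s hs => ?_
    rw [hcov j s hs]
    ring
  rw [← add_assoc, ← Finset.sum_add_distrib, Finset.sum_congr rfl fun j _ => block j,
    Finset.sum_congr rfl fun y _ => Finset.prod_eq_sum_inter_add_ite (hcard y) hagree,
    Finset.sum_add_distrib, ← Finset.sum_filter]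
  congr 1
  simp only [hA]
  rw [← Finset.sum_biUnion fun j _ j' _ h => hdisj j j' h]
  simp only [Finset.mul_sum]
  refine Finset.sum_comm' fun y s => ?_
  simp only [Finset.mem_inter, Finset.mem_filter]
  tauto
end

section
/- In the multilinear single full CPT setting with target set T ⊆ 𝕐 and A_{j,s} = Σ_{y∈T : s∈S(y)} ∏_{l∈S(y)∖{s}} θ_l, suppose each θ_{j_i} ∈ (0,1) is varied to x_j and each θ_s, s ∈ Θ_j∖{j_i}, is covaried proportionally to θ_s(1−x_j)/(1−θ_{j_i}). Then the sensitivity function equals Σ_{j=1}^n a_j x_j + b with a_j = A_{j,j_i} − (1/(1−θ_{j_i})) Σ_{s∈Θ_j∖{j_i}} θ_s A_{j,s} and b = Σ_{j=1}^n (1/(1−θ_{j_i})) Σ_{s∈Θ_j∖{j_i}} θ_s A_{j,s} + Σ_{y∈T : S(y)∩⋃_j Θ_j = ∅} ∏_{l∈S(y)} θ_l. -/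
open Finset in
/-- If `S` meets `U` in at most one index and `f`, `g` agree outside `U`, then `∏ l ∈ S, f l`
expands along the indices of `U`. -/
theorem prod_eq_sum_ite_of_card_inter_le_one {ι R : Type*} [DecidableEq ι] [CommSemiring R]
    {S U : Finset ι} (h : (S ∩ U).card ≤ 1) {f g : ι → R} (hfg : ∀ i, i ∉ U → f i = g i) :
    ∏ l ∈ S, f l =
      (∑ s ∈ U, if s ∈ S then f s * ∏ l ∈ S.erase s, g l else 0) +
        if S ∩ U = ∅ then ∏ l ∈ S, g l else 0 := by
  rw [← sum_filter, filter_mem_eq_inter, inter_comm U S]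
  rcases Nat.le_one_iff_eq_zero_or_eq_one.mp h with h0 | h1
  · rw [card_eq_zero] at h0
    rw [h0, sum_empty, zero_add, if_pos rfl]
    refine prod_congr rfl fun l hl => hfg l fun hU => ?_
    exact notMem_empty l (h0 ▸ mem_inter.mpr ⟨hl, hU⟩)
  · obtain ⟨s, hs⟩ := card_eq_one.mp h1
    have hsS : s ∈ S := (mem_inter.mp (hs ▸ mem_singleton_self s)).1
    rw [hs, sum_singleton, if_neg (singleton_ne_empty s), add_zero, ← mul_prod_erase S f hsS]
    congr 1
    refine prod_congr rfl fun l hl => hfg l fun hU => ?_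
    have hl' : l ∈ S ∩ U := mem_inter.mpr ⟨mem_of_mem_erase hl, hU⟩
    rw [hs, mem_singleton] at hl'
    exact ne_of_mem_erase hl hl'


/-- **Sensitivity function under proportional covariation in a multilinear model.**
In the multilinear single full CPT setting, if each distinguished parameter
`θ (ji j) ∈ (0,1)` is varied to `x j` and each `θ s`, `s ∈ Θ j \ {ji j}`, is covaried
proportionally to `θ s * (1 - x j) / (1 - θ (ji j))`, then the sensitivity function is
affine in `x₁,…,xₙ` with the stated coefficients. -/
theorem stmt_2 {Y : Type} [Fintype Y] [Nonempty Y] {k n : ℕ}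
    (S : Y → Finset (Fin k)) (Θ : Fin n → Finset (Fin k))
    (hdisj : ∀ j j' : Fin n, j ≠ j' → Disjoint (Θ j) (Θ j'))
    (ji : Fin n → Fin k) (hji : ∀ j, ji j ∈ Θ j)
    (hcard : ∀ y : Y, (S y ∩ Finset.univ.biUnion Θ).card ≤ 1)
    (θ : Fin k → ℝ) (hθ : ∀ i, 0 < θ i)
    (hθi : ∀ j, θ (ji j) ∈ Set.Ioo (0 : ℝ) 1)
    (x : Fin n → ℝ) (θt : Fin k → ℝ)
    (hvar : ∀ j, θt (ji j) = x j)
    (hcov : ∀ j, ∀ s ∈ (Θ j).erase (ji j),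
      θt s = θ s * (1 - x j) / (1 - θ (ji j)))
    (hagree : ∀ i, i ∉ Finset.univ.biUnion Θ → θt i = θ i)
    (T : Finset Y) (A : Fin n → Fin k → ℝ)
    (hA : ∀ j s, A j s =
      ∑ y ∈ T.filter (fun y => s ∈ S y), ∏ l ∈ (S y).erase s, θ l) :
    ∑ y ∈ T, ∏ l ∈ S y, θt l =
      (∑ j, (A j (ji j) -
        (1 / (1 - θ (ji j))) * ∑ s ∈ (Θ j).erase (ji j), θ s * A j s) * x j) +
      ((∑ j, (1 / (1 - θ (ji j))) * ∑ s ∈ (Θ j).erase (ji j), θ s * A j s) +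
        ∑ y ∈ T.filter (fun y => S y ∩ Finset.univ.biUnion Θ = ∅),
          ∏ l ∈ S y, θ l) := by
  have expand : ∑ y ∈ T, ∏ l ∈ S y, θt l =
      (∑ j, ∑ s ∈ Θ j, θt s * A j s) +
        ∑ y ∈ T.filter (fun y => S y ∩ Finset.univ.biUnion Θ = ∅), ∏ l ∈ S y, θ l := by
    rw [Finset.sum_congr rfl fun y _ =>
      prod_eq_sum_ite_of_card_inter_le_one (hcard y) hagree, Finset.sum_add_distrib,
      ← Finset.sum_filter, Finset.sum_comm,
      Finset.sum_biUnion fun j _ j' _ hne => hdisj j j' hne]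
    congr 1
    refine Finset.sum_congr rfl fun j _ => Finset.sum_congr rfl fun s _ => ?_
    rw [hA, Finset.mul_sum, Finset.sum_filter]
  rw [expand, ← add_assoc, ← Finset.sum_add_distrib]
  congr 1
  refine Finset.sum_congr rfl fun j _ => ?_
  have hcovsum : ∑ s ∈ (Θ j).erase (ji j), θt s * A j s =
      (1 - x j) * (1 / (1 - θ (ji j)) * ∑ s ∈ (Θ j).erase (ji j), θ s * A j s) := by
    rw [Finset.mul_sum, Finset.mul_sum]
    refine Finset.sum_congr rfl fun s hs => ?_
    rw [hcov j s hs]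
    ring
  rw [← Finset.add_sum_erase _ _ (hji j), hvar, hcovsum]
  ring
end

section
/- In the multilinear single full CPT setting, let T, O ⊆ 𝕐 with Σ_{y∈O} p_{θ̃}(y) > 0, and suppose θ̃ arises from θ by a linear covariation scheme: θ̃_{j_i} = x_j and θ̃_s = γ_s x_j + δ_s for s ∈ Θ_j∖{j_i}. Then the posterior sensitivity function (Σ_{y∈T∩O} p_{θ̃}(y)) / (Σ_{y∈O} p_{θ̃}(y)) equals (Σ_{j=1}^n a_j x_j + b) / (Σ_{j=1}^n c_j x_j + d) for real coefficients a_j, b, c_j, d not depending on x_1,…,x_n; i.e., it is a ratio of two functions each affine in every varied parameter. -/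
/-- The function `f` of the parameter vector is affine in the values `x`, uniformly over all pairs
`(x, t)` related by `P`. -/
def IsAffineIn {ι κ : Type*} [Fintype ι] (P : (ι → ℝ) → (κ → ℝ) → Prop) (f : (κ → ℝ) → ℝ) : Prop :=
  ∃ (a : ι → ℝ) (b : ℝ), ∀ x t, P x t → f t = (∑ j, a j * x j) + b

namespace IsAffineIn

variable {ι κ : Type*} [Fintype ι] {P : (ι → ℝ) → (κ → ℝ) → Prop}

theorem of_eq_const {f : (κ → ℝ) → ℝ} (r : ℝ) (h : ∀ x t, P x t → f t = r) : IsAffineIn P f :=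
  ⟨0, r, fun x t ht => by simp [h x t ht]⟩

theorem of_eq_coord {f : (κ → ℝ) → ℝ} [DecidableEq ι] (j : ι) (g r : ℝ)
    (h : ∀ x t, P x t → f t = g * x j + r) : IsAffineIn P f :=
  ⟨Pi.single j g, r, fun x t ht => by simp [h x t ht, Pi.single_apply]⟩

theorem of_eq_mul_const {f g : (κ → ℝ) → ℝ} (hf : IsAffineIn P f) (r : ℝ)
    (h : ∀ x t, P x t → g t = f t * r) : IsAffineIn P g := by
  obtain ⟨a, b, hab⟩ := hf
  refine ⟨fun j => a j * r, b * r, fun x t ht => ?_⟩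
  rw [h x t ht, hab x t ht, add_mul, Finset.sum_mul]
  simp only [mul_right_comm]

theorem sum {Y : Type*} {f : Y → (κ → ℝ) → ℝ} (hf : ∀ y, IsAffineIn P (f y)) (s : Finset Y) :
    IsAffineIn P fun t => ∑ y ∈ s, f y t := by
  choose a b hab using hf
  refine ⟨fun j => ∑ y ∈ s, a y j, ∑ y ∈ s, b y, fun x t ht => ?_⟩
  simp only [hab _ x t ht, Finset.sum_add_distrib, Finset.sum_mul]
  rw [Finset.sum_comm]

/-- A monomial with at most one factor in `B` is affine if each coordinate in `B` is affine and the
coordinates outside `B` are fixed. -/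
theorem prod_of_card_inter_le_one [DecidableEq κ] {B s : Finset κ} {θ : κ → ℝ}
    (hB : ∀ i ∈ B, IsAffineIn P fun t => t i) (hfix : ∀ x t, P x t → ∀ i ∉ B, t i = θ i)
    (hs : (s ∩ B).card ≤ 1) : IsAffineIn P fun t => ∏ l ∈ s, t l := by
  have hsplit : ∀ x t, P x t → ∏ l ∈ s, t l = (∏ l ∈ s ∩ B, t l) * ∏ l ∈ s \ B, θ l := by
    intro x t ht
    rw [← Finset.prod_inter_mul_prod_sdiff s B]
    congr 1
    exact Finset.prod_congr rfl fun i hi => hfix x t ht i (Finset.mem_sdiff.1 hi).2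
  refine of_eq_mul_const ?_ _ hsplit
  rcases Nat.le_one_iff_eq_zero_or_eq_one.1 hs with h | h
  · exact of_eq_const 1 fun _ _ _ => by rw [Finset.card_eq_zero.1 h, Finset.prod_empty]
  · obtain ⟨i, hi⟩ := Finset.card_eq_one.1 h
    have hiB : i ∈ B := (Finset.mem_inter.1 (hi ▸ Finset.mem_singleton_self i)).2
    simpa only [hi, Finset.prod_singleton] using hB i hiB

end IsAffineIn


/-- **Posterior sensitivity functions in multilinear models are ratios of affine
functions.**  In the multilinear single full CPT setting with a linear covariation
scheme, there exist coefficients `a j, b, c j, d` (not depending on the varied values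
`x`) such that whenever `θt` arises from `θ` by the linear scheme with values `x` and
the probability of the observed event `O` is positive, the posterior sensitivity
function `(∑_{y∈T∩O} p_{θt}(y)) / (∑_{y∈O} p_{θt}(y))` equals
`(∑ j, a j * x j + b) / (∑ j, c j * x j + d)`. -/
theorem stmt_3 {Y : Type} [Fintype Y] [DecidableEq Y] [Nonempty Y] {k n : ℕ}
    (S : Y → Finset (Fin k)) (Θ : Fin n → Finset (Fin k))
    (hdisj : ∀ j j' : Fin n, j ≠ j' → Disjoint (Θ j) (Θ j'))
    (ji : Fin n → Fin k) (hji : ∀ j, ji j ∈ Θ j)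
    (hcard : ∀ y : Y, (S y ∩ Finset.univ.biUnion Θ).card ≤ 1)
    (θ : Fin k → ℝ) (hθ : ∀ i, 0 < θ i)
    (γ δ : Fin k → ℝ) (T O : Finset Y) :
    ∃ (a : Fin n → ℝ) (b : ℝ) (c : Fin n → ℝ) (d : ℝ),
      ∀ (x : Fin n → ℝ) (θt : Fin k → ℝ),
        (∀ j, θt (ji j) = x j) →
        (∀ j, ∀ s ∈ (Θ j).erase (ji j), θt s = γ s * x j + δ s) →
        (∀ i, i ∉ Finset.univ.biUnion Θ → θt i = θ i) →
        0 < ∑ y ∈ O, ∏ l ∈ S y, θt l →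
        (∑ y ∈ T ∩ O, ∏ l ∈ S y, θt l) / (∑ y ∈ O, ∏ l ∈ S y, θt l) =
          ((∑ j, a j * x j) + b) / ((∑ j, c j * x j) + d) := by
  let P : (Fin n → ℝ) → (Fin k → ℝ) → Prop := fun x t =>
    (∀ j, t (ji j) = x j) ∧ (∀ j, ∀ s ∈ (Θ j).erase (ji j), t s = γ s * x j + δ s) ∧
      ∀ i, i ∉ Finset.univ.biUnion Θ → t i = θ i
  have hcoord : ∀ i ∈ Finset.univ.biUnion Θ, IsAffineIn P fun t => t i := by
    intro i hi
    obtain ⟨j, -, hj⟩ := Finset.mem_biUnion.1 hi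
    by_cases hij : i = ji j
    · exact .of_eq_coord j 1 0 fun x t ht => by simp [hij, ht.1 j]
    · exact .of_eq_coord j (γ i) (δ i) fun x t ht =>
        ht.2.1 j i (Finset.mem_erase.2 ⟨hij, hj⟩)
  have hatom : ∀ y, IsAffineIn P fun t => ∏ l ∈ S y, t l := fun y =>
    .prod_of_card_inter_le_one hcoord (fun x t ht => ht.2.2) (hcard y)
  obtain ⟨a, b, hab⟩ := IsAffineIn.sum hatom (T ∩ O)
  obtain ⟨c, d, hcd⟩ := IsAffineIn.sum hatom O
  refine ⟨a, b, c, d, fun x t h₁ h₂ h₃ _ => ?_⟩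
  exact congrArg₂ (· / ·) (hab x t ⟨h₁, h₂, h₃⟩) (hcd x t ⟨h₁, h₂, h₃⟩)
end

section
/- In the multilinear single full CPT setting, suppose both θ and θ̃ have strictly positive entries, both are valid (Σ_{s∈Θ_j} θ_s = Σ_{s∈Θ_j} θ̃_s = 1 for every j), θ̃ agrees with θ outside ⋃_j Θ_j, and every block index s ∈ Θ_j occurs in S(y) for at least one atom y ∈ 𝕐. Then the Chan–Darwiche distance between p_θ and p_{θ̃} equals log max_{j∈[n], s∈Θ_j} (θ̃_s/θ_s) − log min_{j∈[n], s∈Θ_j} (θ̃_s/θ_s); in particular it depends only on the varied and covaried parameters. -/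
/-- At an index of `s ∩ B`, the ratio of products over `s` is the ratio of the values there. -/
theorem prod_div_prod_eq_of_mem {ι : Type*} [DecidableEq ι] {s B : Finset ι} {f g : ι → ℝ}
    (hg : ∀ i, 0 < g i) (hcard : (s ∩ B).card ≤ 1) (hagree : ∀ i, i ∉ B → f i = g i)
    {i : ι} (hi : i ∈ s ∩ B) :
    (∏ l ∈ s, f l) / ∏ l ∈ s, g l = f i / g i := by
  rw [← Finset.prod_div_distrib]
  refine Finset.prod_eq_single_of_mem i (Finset.mem_inter.1 hi).1 fun j hj hji => ?_
  have hjB : j ∉ B := fun h =>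
    hji (Finset.card_le_one.1 hcard j (Finset.mem_inter.2 ⟨hj, h⟩) i hi)
  rw [hagree j hjB, div_self (hg j).ne']

/-- If `f` and `g` agree on `s` outside `B` and `s` meets `B` in at most one index, the ratio of
their products over `s` is either `1` or the ratio of their values at an index of `s ∩ B`. -/
theorem prod_div_prod_eq_one_or {ι : Type*} [DecidableEq ι] {s B : Finset ι} {f g : ι → ℝ}
    (hg : ∀ i, 0 < g i) (hcard : (s ∩ B).card ≤ 1) (hagree : ∀ i, i ∉ B → f i = g i) :
    (∏ l ∈ s, f l) / ∏ l ∈ s, g l = 1 ∨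
      ∃ i ∈ s ∩ B, (∏ l ∈ s, f l) / ∏ l ∈ s, g l = f i / g i := by
  rcases (s ∩ B).eq_empty_or_nonempty with h | ⟨i, hi⟩
  · left
    rw [← Finset.prod_div_distrib]
    refine Finset.prod_eq_one fun i hi => ?_
    have hiB : i ∉ B := fun hB => Finset.notMem_empty i (h ▸ Finset.mem_inter.2 ⟨hi, hB⟩)
    rw [hagree i hiB, div_self (hg i).ne']
  · exact Or.inr ⟨i, hi, prod_div_prod_eq_of_mem hg hcard hagree hi⟩


/-- **The Chan–Darwiche distance in a multilinear single full CPT analysis depends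
only on the varied and covaried parameters.**  If `θ` and `θt` are strictly positive,
both are valid on every block (`∑_{s ∈ Θ j} θ s = ∑_{s ∈ Θ j} θt s = 1`), `θt`
agrees with `θ` outside the blocks, and every block index occurs in some monomial,
then `D_CD(p_θ, p_{θt}) = log max_{j,s∈Θ j} θt s / θ s − log min_{j,s∈Θ j} θt s / θ s`. -/
theorem stmt_4 {Y : Type} [Fintype Y] [Nonempty Y] {k n : ℕ}
    (S : Y → Finset (Fin k)) (Θ : Fin n → Finset (Fin k))
    (hdisj : ∀ j j' : Fin n, j ≠ j' → Disjoint (Θ j) (Θ j'))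
    (ji : Fin n → Fin k) (hji : ∀ j, ji j ∈ Θ j)
    (hcard : ∀ y : Y, (S y ∩ Finset.univ.biUnion Θ).card ≤ 1)
    (θ θt : Fin k → ℝ) (hθ : ∀ i, 0 < θ i) (hθt : ∀ i, 0 < θt i)
    (hvalid : ∀ j, ∑ s ∈ Θ j, θ s = 1) (hvalidt : ∀ j, ∑ s ∈ Θ j, θt s = 1)
    (hagree : ∀ i, i ∉ Finset.univ.biUnion Θ → θt i = θ i)
    (hocc : ∀ j, ∀ s ∈ Θ j, ∃ y : Y, s ∈ S y)
    (hB : (Finset.univ.biUnion Θ).Nonempty) :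
    Real.log (Finset.univ.sup' Finset.univ_nonempty
        (fun y : Y => (∏ l ∈ S y, θt l) / ∏ l ∈ S y, θ l)) -
      Real.log (Finset.univ.inf' Finset.univ_nonempty
        (fun y : Y => (∏ l ∈ S y, θt l) / ∏ l ∈ S y, θ l)) =
    Real.log ((Finset.univ.biUnion Θ).sup' hB (fun s => θt s / θ s)) -
      Real.log ((Finset.univ.biUnion Θ).inf' hB (fun s => θt s / θ s)) := by
  have hex : ∀ i ∈ Finset.univ.biUnion Θ, ∃ y, i ∈ S y ∩ Finset.univ.biUnion Θ := by
    intro i hi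
    obtain ⟨j, -, hj⟩ := Finset.mem_biUnion.1 hi
    obtain ⟨y, hy⟩ := hocc j i hj
    exact ⟨y, Finset.mem_inter.2 ⟨hy, hi⟩⟩
  obtain ⟨i₀, hi₀⟩ := hB
  obtain ⟨j, -, hj⟩ := Finset.mem_biUnion.1 hi₀
  have hsub : ∀ s ∈ Θ j, s ∈ Finset.univ.biUnion Θ := fun s hs =>
    Finset.mem_biUnion.2 ⟨j, Finset.mem_univ j, hs⟩
  obtain ⟨a, ha, hale⟩ := Finset.exists_le_of_sum_le ⟨i₀, hj⟩
    ((hvalid j).trans (hvalidt j).symm).le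
  obtain ⟨b, hb, hble⟩ := Finset.exists_le_of_sum_le ⟨i₀, hj⟩
    ((hvalidt j).trans (hvalid j).symm).le
  congr 2
  · apply le_antisymm
    · refine Finset.sup'_le _ _ fun y _ => ?_
      rcases prod_div_prod_eq_one_or hθ (hcard y) hagree with h | ⟨i, hi, h⟩
      · rw [h]
        exact ((one_le_div (hθ a)).2 hale).trans
          (Finset.le_sup' (fun s => θt s / θ s) (hsub a ha))
      · rw [h]
        exact Finset.le_sup' (fun s => θt s / θ s) (Finset.mem_inter.1 hi).2
    · refine Finset.sup'_le _ _ fun i hi => ?_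
      obtain ⟨y, hy⟩ := hex i hi
      rw [← prod_div_prod_eq_of_mem hθ (hcard y) hagree hy]
      exact Finset.le_sup' (fun y => (∏ l ∈ S y, θt l) / ∏ l ∈ S y, θ l) (Finset.mem_univ y)
  · apply le_antisymm
    · refine Finset.le_inf' _ _ fun i hi => ?_
      obtain ⟨y, hy⟩ := hex i hi
      rw [← prod_div_prod_eq_of_mem hθ (hcard y) hagree hy]
      exact Finset.inf'_le (fun y => (∏ l ∈ S y, θt l) / ∏ l ∈ S y, θ l) (Finset.mem_univ y)
    · refine Finset.le_inf' _ _ fun y _ => ?_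
      rcases prod_div_prod_eq_one_or hθ (hcard y) hagree with h | ⟨i, hi, h⟩
      · rw [h]
        exact (Finset.inf'_le (fun s => θt s / θ s) (hsub b hb)).trans
          ((div_le_one (hθ b)).2 hble)
      · rw [h]
        exact Finset.inf'_le (fun s => θt s / θ s) (Finset.mem_inter.1 hi).2
end

section
/- Let r ≥ 2, let θ = (θ_1,…,θ_r) ∈ (0,1)^r with Σ_{s=1}^r θ_s = 1, fix i ∈ {1,…,r} and t ∈ (0,1), and define the proportional covariation θ̃ by θ̃_i = t and θ̃_s = θ_s (1−t)/(1−θ_i) for s ≠ i. Then for every θ̄ ∈ (0,1)^r with Σ_{s=1}^r θ̄_s = 1 and θ̄_i = t one has max_{s∈[r]} θ̄_s/θ_s ≥ max{t/θ_i, (1−t)/(1−θ_i)} and min_{s∈[r]} θ̄_s/θ_s ≤ min{t/θ_i, (1−t)/(1−θ_i)}; consequently log max_s θ̄_s/θ_s − log min_s θ̄_s/θ_s ≥ log max_s θ̃_s/θ_s − log min_s θ̃_s/θ_s, i.e., among all ways of covarying the remaining parameters after varying θ_i to t, proportional covariation minimizes the Chan–Darwiche distance between the two probability vectors. -/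
/-- A ratio of sums is at most any common upper bound of the ratios of the summands. -/
theorem sum_div_sum_le_of_forall_div_le {ι : Type*} {S : Finset ι} {f g : ι → ℝ} {M : ℝ}
    (hg : ∀ s ∈ S, 0 < g s) (hS : 0 < ∑ s ∈ S, g s) (h : ∀ s ∈ S, f s / g s ≤ M) :
    (∑ s ∈ S, f s) / ∑ s ∈ S, g s ≤ M := by
  rw [div_le_iff₀ hS, Finset.mul_sum]
  exact Finset.sum_le_sum fun s hs => (div_le_iff₀ (hg s hs)).1 (h s hs)

/-- A ratio of sums is at least any common lower bound of the ratios of the summands. -/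
theorem le_sum_div_sum_of_forall_le_div {ι : Type*} {S : Finset ι} {f g : ι → ℝ} {m : ℝ}
    (hg : ∀ s ∈ S, 0 < g s) (hS : 0 < ∑ s ∈ S, g s) (h : ∀ s ∈ S, m ≤ f s / g s) :
    m ≤ (∑ s ∈ S, f s) / ∑ s ∈ S, g s := by
  rw [le_div_iff₀ hS, Finset.mul_sum]
  exact Finset.sum_le_sum fun s hs => (le_div_iff₀ (hg s hs)).1 (h s hs)


/-- **Proportional covariation minimizes the Chan–Darwiche distance for a single
parameter change.**  Let `θ ∈ (0,1)^r` be a probability vector, `i` a coordinate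
varied to `t ∈ (0,1)`, and `θt` the proportional covariation.  Then for any
probability vector `θb ∈ (0,1)^r` with `θb i = t`, the maximal ratio `θb s / θ s`
dominates `max (t/θ i) ((1-t)/(1-θ i))`, the minimal ratio is dominated by
`min (t/θ i) ((1-t)/(1-θ i))`, and consequently the Chan–Darwiche distance from `θ`
to `θb` is at least that from `θ` to `θt`. -/
theorem stmt_5 {r : ℕ} (hr : 2 ≤ r) (θ : Fin r → ℝ)
    (hθ : ∀ s, θ s ∈ Set.Ioo (0 : ℝ) 1) (hsum : ∑ s, θ s = 1)
    (i : Fin r) (t : ℝ) (ht : t ∈ Set.Ioo (0 : ℝ) 1)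
    (θt : Fin r → ℝ) (hti : θt i = t)
    (hts : ∀ s, s ≠ i → θt s = θ s * (1 - t) / (1 - θ i))
    (θb : Fin r → ℝ) (hθb : ∀ s, θb s ∈ Set.Ioo (0 : ℝ) 1)
    (hsumb : ∑ s, θb s = 1) (hbi : θb i = t) :
    (Finset.univ.sup' ⟨⟨0, by omega⟩, Finset.mem_univ _⟩
        (fun s : Fin r => θb s / θ s) ≥ max (t / θ i) ((1 - t) / (1 - θ i))) ∧
    (Finset.univ.inf' ⟨⟨0, by omega⟩, Finset.mem_univ _⟩
        (fun s : Fin r => θb s / θ s) ≤ min (t / θ i) ((1 - t) / (1 - θ i))) ∧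
    (Real.log (Finset.univ.sup' ⟨⟨0, by omega⟩, Finset.mem_univ _⟩
        (fun s : Fin r => θb s / θ s)) -
      Real.log (Finset.univ.inf' ⟨⟨0, by omega⟩, Finset.mem_univ _⟩
        (fun s : Fin r => θb s / θ s)) ≥
      Real.log (Finset.univ.sup' ⟨⟨0, by omega⟩, Finset.mem_univ _⟩
        (fun s : Fin r => θt s / θ s)) -
      Real.log (Finset.univ.inf' ⟨⟨0, by omega⟩, Finset.mem_univ _⟩
        (fun s : Fin r => θt s / θ s))) := by
  have hne : (Finset.univ : Finset (Fin r)).Nonempty := ⟨i, Finset.mem_univ i⟩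
  have hpos : ∀ s, 0 < θ s := fun s => (hθ s).1
  have hi : 0 < 1 - θ i := sub_pos.2 (hθ i).2
  have ht1 : 0 < 1 - t := sub_pos.2 ht.2
  have hrest : ∑ s ∈ Finset.univ.erase i, θ s = 1 - θ i := by
    rw [← hsum, ← Finset.add_sum_erase _ θ (Finset.mem_univ i)]; ring
  have hrestb : ∑ s ∈ Finset.univ.erase i, θb s = 1 - t := by
    rw [← hsumb, ← hbi, ← Finset.add_sum_erase _ θb (Finset.mem_univ i)]; ring
  have hmax : max (t / θ i) ((1 - t) / (1 - θ i)) ≤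
      Finset.univ.sup' hne (fun s => θb s / θ s) := by
    have hle : ∀ s, θb s / θ s ≤ Finset.univ.sup' hne (fun s => θb s / θ s) := fun s =>
      Finset.le_sup' (fun s => θb s / θ s) (Finset.mem_univ s)
    refine max_le (hbi ▸ hle i) ?_
    rw [← hrest, ← hrestb]
    exact sum_div_sum_le_of_forall_div_le (fun s _ => hpos s) (hrest ▸ hi) fun s _ => hle s
  have hmin : Finset.univ.inf' hne (fun s => θb s / θ s) ≤
      min (t / θ i) ((1 - t) / (1 - θ i)) := by
    have hle : ∀ s, Finset.univ.inf' hne (fun s => θb s / θ s) ≤ θb s / θ s := fun s =>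
      Finset.inf'_le (fun s => θb s / θ s) (Finset.mem_univ s)
    refine le_min (hbi ▸ hle i) ?_
    rw [← hrest, ← hrestb]
    exact le_sum_div_sum_of_forall_le_div (fun s _ => hpos s) (hrest ▸ hi) fun s _ => hle s
  have hratio : ∀ s, θt s / θ s = t / θ i ∨ θt s / θ s = (1 - t) / (1 - θ i) := by
    intro s
    by_cases hs : s = i
    · left; rw [hs, hti]
    · right
      rw [hts s hs, mul_div_assoc, mul_div_cancel_left₀ _ (hpos s).ne']
  have hmaxt : Finset.univ.sup' hne (fun s => θt s / θ s) ≤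
      max (t / θ i) ((1 - t) / (1 - θ i)) :=
    Finset.sup'_le _ _ fun s _ => by rcases hratio s with h | h <;> simp [h]
  have hmint : min (t / θ i) ((1 - t) / (1 - θ i)) ≤
      Finset.univ.inf' hne (fun s => θt s / θ s) :=
    Finset.le_inf' _ _ fun s _ => by rcases hratio s with h | h <;> simp [h]
  have hinfb : 0 < Finset.univ.inf' hne (fun s => θb s / θ s) :=
    (Finset.lt_inf'_iff _).2 fun s _ => div_pos (hθb s).1 (hpos s)
  have hsupt : 0 < Finset.univ.sup' hne (fun s => θt s / θ s) :=
    (Finset.lt_sup'_iff _).2 ⟨i, Finset.mem_univ i, by rw [hti]; exact div_pos ht.1 (hpos i)⟩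
  exact ⟨hmax, hmin, sub_le_sub (Real.log_le_log hsupt (hmaxt.trans hmax))
    (Real.log_le_log hinfb (hmin.trans hmint))⟩
end

section
/- In the multilinear single full CPT setting, suppose θ has strictly positive entries and is valid (Σ_{s∈Θ_j} θ_s = 1 for every j), every block index occurs in S(y) for at least one atom y, each θ_{j_i} ∈ (0,1), and θ̃ is obtained by varying θ_{j_i} to θ̃_{j_i} ∈ (0,1) and covarying proportionally: θ̃_s = θ_s(1−θ̃_{j_i})/(1−θ_{j_i}) for s ∈ Θ_j∖{j_i}, leaving θ unchanged outside the blocks. Then D_CD(p_θ, p_{θ̃}) = log max_{j∈[n]} max{θ̃_{j_i}/θ_{j_i}, (1−θ̃_{j_i})/(1−θ_{j_i})} − log min_{j∈[n]} min{θ̃_{j_i}/θ_{j_i}, (1−θ̃_{j_i})/(1−θ_{j_i})}. -/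
/-- If `f` and `g` differ at no point of `S` other than `s ∈ S`, and `g` has no zero, then the ratio
of their products over `S` is the ratio of their values at `s`. -/
theorem prod_div_prod_eq_div_of_mem {ι : Type*} {S : Finset ι} {f g : ι → ℝ} (hg : ∀ i, g i ≠ 0)
    {s : ι} (hs : s ∈ S) (h : ∀ l ∈ S, l ≠ s → f l = g l) :
    (∏ l ∈ S, f l) / ∏ l ∈ S, g l = f s / g s := by
  rw [← Finset.prod_div_distrib]
  refine Finset.prod_eq_single s (fun l hl hne => ?_) (fun hn => absurd hs hn)
  rw [h l hl hne, div_self (hg l)]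

/-- For `x, y ∈ (0,1)`, the number `1` lies between `y / x` and `(1 - y) / (1 - x)`. -/
theorem min_le_one_and_one_le_max_div {x y : ℝ} (hx : x ∈ Set.Ioo (0 : ℝ) 1) :
    min (y / x) ((1 - y) / (1 - x)) ≤ 1 ∧ 1 ≤ max (y / x) ((1 - y) / (1 - x)) := by
  have hx0 : 0 < x := hx.1
  have hx1 : 0 < 1 - x := sub_pos.2 hx.2
  rw [min_le_iff, le_max_iff, div_le_one hx0, div_le_one hx1, one_le_div hx0, one_le_div hx1]
  rcases le_total x y with h | h
  · exact ⟨Or.inr (by linarith), Or.inl h⟩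
  · exact ⟨Or.inl h, Or.inr (by linarith)⟩

/-- **Closed form of the Chan–Darwiche distance under proportional covariation in a
single full CPT analysis of a multilinear model.**  If `θ` is valid and strictly
positive, every block index occurs in some monomial, each distinguished parameter
`θ (ji j) ∈ (0,1)` is varied to `θt (ji j) ∈ (0,1)` and the other block parameters
are covaried proportionally, then
`D_CD(p_θ, p_{θt}) = log max_j max{θt(ji j)/θ(ji j), (1−θt(ji j))/(1−θ(ji j))}
  − log min_j min{θt(ji j)/θ(ji j), (1−θt(ji j))/(1−θ(ji j))}`. -/
theorem stmt_6 {Y : Type} [Fintype Y] [Nonempty Y] {k n : ℕ} (hn : 0 < n)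
    (S : Y → Finset (Fin k)) (Θ : Fin n → Finset (Fin k))
    (hdisj : ∀ j j' : Fin n, j ≠ j' → Disjoint (Θ j) (Θ j'))
    (ji : Fin n → Fin k) (hji : ∀ j, ji j ∈ Θ j)
    (hcard : ∀ y : Y, (S y ∩ Finset.univ.biUnion Θ).card ≤ 1)
    (θ θt : Fin k → ℝ) (hθ : ∀ i, 0 < θ i)
    (hvalid : ∀ j, ∑ s ∈ Θ j, θ s = 1)
    (hocc : ∀ j, ∀ s ∈ Θ j, ∃ y : Y, s ∈ S y)
    (hθi : ∀ j, θ (ji j) ∈ Set.Ioo (0 : ℝ) 1)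
    (hθti : ∀ j, θt (ji j) ∈ Set.Ioo (0 : ℝ) 1)
    (hcov : ∀ j, ∀ s ∈ (Θ j).erase (ji j),
      θt s = θ s * (1 - θt (ji j)) / (1 - θ (ji j)))
    (hagree : ∀ i, i ∉ Finset.univ.biUnion Θ → θt i = θ i) :
    Real.log (Finset.univ.sup' Finset.univ_nonempty
        (fun y : Y => (∏ l ∈ S y, θt l) / ∏ l ∈ S y, θ l)) -
      Real.log (Finset.univ.inf' Finset.univ_nonempty
        (fun y : Y => (∏ l ∈ S y, θt l) / ∏ l ∈ S y, θ l)) =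
    Real.log (Finset.univ.sup' ⟨⟨0, hn⟩, Finset.mem_univ _⟩
        (fun j : Fin n => max (θt (ji j) / θ (ji j))
          ((1 - θt (ji j)) / (1 - θ (ji j))))) -
      Real.log (Finset.univ.inf' ⟨⟨0, hn⟩, Finset.mem_univ _⟩
        (fun j : Fin n => min (θt (ji j) / θ (ji j))
          ((1 - θt (ji j)) / (1 - θ (ji j))))) := by
  have hθ0 : ∀ i, θ i ≠ 0 := fun i => (hθ i).ne'
  have ratio_of_mem : ∀ y j, ∀ s ∈ Θ j, s ∈ S y →
      (∏ l ∈ S y, θt l) / ∏ l ∈ S y, θ l = θt s / θ s := by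
    intro y j s hs hsy
    refine prod_div_prod_eq_div_of_mem hθ0 hsy fun l hl hne => hagree l fun hlU => hne ?_
    exact Finset.card_le_one.1 (hcard y) l (Finset.mem_inter.2 ⟨hl, hlU⟩) s
      (Finset.mem_inter.2 ⟨hsy, Finset.mem_biUnion.2 ⟨j, Finset.mem_univ _, hs⟩⟩)
  have ratio_cov : ∀ j, ∀ s ∈ Θ j, s ≠ ji j →
      θt s / θ s = (1 - θt (ji j)) / (1 - θ (ji j)) := by
    intro j s hs hne
    rw [hcov j s (Finset.mem_erase.2 ⟨hne, hs⟩), mul_div_assoc, mul_div_cancel_left₀ _ (hθ0 s)]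
  have attained_dist : ∀ j, ∃ y : Y,
      (∏ l ∈ S y, θt l) / ∏ l ∈ S y, θ l = θt (ji j) / θ (ji j) := by
    intro j
    obtain ⟨y, hy⟩ := hocc j _ (hji j)
    exact ⟨y, ratio_of_mem y j _ (hji j) hy⟩
  have attained_cov : ∀ j, ∃ y : Y,
      (∏ l ∈ S y, θt l) / ∏ l ∈ S y, θ l = (1 - θt (ji j)) / (1 - θ (ji j)) := by
    intro j
    obtain ⟨s, hs, hne⟩ : ∃ s ∈ Θ j, s ≠ ji j := by
      by_contra! h
      have hsum := hvalid j
      rw [Finset.sum_eq_single_of_mem (ji j) (hji j) fun b hb hb' => absurd (h b hb) hb'] at hsum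
      exact (hθi j).2.ne hsum
    obtain ⟨y, hy⟩ := hocc j s hs
    exact ⟨y, (ratio_of_mem y j s hs hy).trans (ratio_cov j s hs hne)⟩
  have between : ∀ y, ∃ j,
      min (θt (ji j) / θ (ji j)) ((1 - θt (ji j)) / (1 - θ (ji j))) ≤
        (∏ l ∈ S y, θt l) / ∏ l ∈ S y, θ l ∧
      (∏ l ∈ S y, θt l) / ∏ l ∈ S y, θ l ≤
        max (θt (ji j) / θ (ji j)) ((1 - θt (ji j)) / (1 - θ (ji j))) := by
    intro y
    by_cases h : ∃ j, ∃ s ∈ Θ j, s ∈ S y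
    · obtain ⟨j, s, hs, hsy⟩ := h
      refine ⟨j, ?_⟩
      rw [ratio_of_mem y j s hs hsy]
      by_cases hne : s = ji j
      · rw [hne]
        exact ⟨min_le_left _ _, le_max_left _ _⟩
      · rw [ratio_cov j s hs hne]
        exact ⟨min_le_right _ _, le_max_right _ _⟩
    · push Not at h
      have hprod : ∏ l ∈ S y, θt l = ∏ l ∈ S y, θ l := by
        refine Finset.prod_congr rfl fun l hl => hagree l fun hlU => ?_
        obtain ⟨j, -, hj⟩ := Finset.mem_biUnion.1 hlU
        exact h j l hj hl
      rw [hprod, div_self (Finset.prod_ne_zero_iff.2 fun i _ => hθ0 i)]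
      exact ⟨⟨0, hn⟩, min_le_one_and_one_le_max_div (hθi _)⟩
  congr 2
  · apply le_antisymm
    · refine Finset.sup'_le _ _ fun y _ => ?_
      obtain ⟨j, -, hj⟩ := between y
      exact Finset.le_sup'_of_le _ (Finset.mem_univ j) hj
    · refine Finset.sup'_le _ _ fun j _ => max_le ?_ ?_
      · obtain ⟨y, hy⟩ := attained_dist j
        exact Finset.le_sup'_of_le _ (Finset.mem_univ y) hy.ge
      · obtain ⟨y, hy⟩ := attained_cov j
        exact Finset.le_sup'_of_le _ (Finset.mem_univ y) hy.ge
  · apply le_antisymm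
    · refine Finset.le_inf' _ _ fun j _ => le_min ?_ ?_
      · obtain ⟨y, hy⟩ := attained_dist j
        exact Finset.inf'_le_of_le _ (Finset.mem_univ y) hy.le
      · obtain ⟨y, hy⟩ := attained_cov j
        exact Finset.inf'_le_of_le _ (Finset.mem_univ y) hy.le
    · refine Finset.le_inf' _ _ fun y _ => ?_
      obtain ⟨j, hj, -⟩ := between y
      exact Finset.inf'_le_of_le _ (Finset.mem_univ j) hj
end

section
/- In the multilinear single full CPT setting, suppose θ has strictly positive entries and is valid (Σ_{s∈Θ_j} θ_s = 1 for every j), every block index occurs in S(y) for at least one atom y, and each θ_{j_i} ∈ (0,1). Fix target values t_j ∈ (0,1) for j ∈ [n], and let θ̃ be the proportional covariation: θ̃_{j_i} = t_j and θ̃_s = θ_s(1−t_j)/(1−θ_{j_i}) for s ∈ Θ_j∖{j_i}. Then for every θ̄ with strictly positive entries that agrees with θ outside ⋃_j Θ_j, satisfies θ̄_{j_i} = t_j for every j, and is valid (Σ_{s∈Θ_j} θ̄_s = 1 for every j), one has D_CD(p_θ, p_{θ̄}) ≥ D_CD(p_θ, p_{θ̃}); that is, proportional covariation minimizes the Chan–Darwiche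 distance among all valid covariation schemes in single full CPT analyses of multilinear models. -/
open Finset in
/-- If `p` and `q` agree off `U` and `S` meets `U` at most in `s`, the ratio of the monomials
of `p` and `q` supported on `S` is `p s / q s`. -/
theorem prod_div_prod_eq_div_of_mem_s7 {ι : Type*} [DecidableEq ι] {S U : Finset ι} {p q : ι → ℝ}
    (hq : ∀ i, 0 < q i) (hcard : (S ∩ U).card ≤ 1) (hpq : ∀ i, i ∉ U → p i = q i)
    {s : ι} (hs : s ∈ S) (hsU : s ∈ U) :
    (∏ l ∈ S, p l) / ∏ l ∈ S, q l = p s / q s := by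
  rw [← prod_div_distrib]
  refine prod_eq_single_of_mem s hs fun i hi his => ?_
  have hiU : i ∉ U := fun hiU =>
    his (card_le_one.1 hcard i (mem_inter.2 ⟨hi, hiU⟩) s (mem_inter.2 ⟨hs, hsU⟩))
  rw [hpq i hiU, div_self (hq i).ne']

/-- If `p` and `q` agree off `U` and `S` does not meet `U`, the monomials supported on `S`
have the same value at `p` and `q`. -/
theorem prod_div_prod_eq_one_of_forall_notMem {ι : Type*} {S U : Finset ι} {p q : ι → ℝ}
    (hq : ∀ i, 0 < q i) (hpq : ∀ i, i ∉ U → p i = q i) (hS : ∀ s ∈ S, s ∉ U) :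
    (∏ l ∈ S, p l) / ∏ l ∈ S, q l = 1 := by
  rw [← Finset.prod_div_distrib]
  exact Finset.prod_eq_one fun i hi => by rw [hpq i (hS i hi), div_self (hq i).ne']

/-- Proportional covariation on a block `T` with distinguished index `i`: among all
redistributions with the same value at `i` and the same total mass, each of its ratios is
enclosed between two ratios of the competitor. -/
theorem exists_div_le_and_exists_le_div {ι : Type*} [DecidableEq ι] {T : Finset ι} {i : ι}
    (hi : i ∈ T) {θ θt θb : ι → ℝ} {t : ℝ} (hθ : ∀ s, 0 < θ s) (hsum : ∑ s ∈ T, θ s = 1)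
    (hθi : θ i < 1) (hti : θt i = t)
    (hts : ∀ s ∈ T.erase i, θt s = θ s * (1 - t) / (1 - θ i))
    (hbi : θb i = t) (hbsum : ∑ s ∈ T, θb s = 1) {s : ι} (hs : s ∈ T) :
    (∃ s' ∈ T, θb s' / θ s' ≤ θt s / θ s) ∧ ∃ s' ∈ T, θt s / θ s ≤ θb s' / θ s' := by
  rcases eq_or_ne s i with rfl | hne
  · exact ⟨⟨s, hs, by rw [hti, hbi]⟩, s, hs, by rw [hti, hbi]⟩
  have h0 : 1 - θ i ≠ 0 := by linarith
  have hse : s ∈ T.erase i := Finset.mem_erase.2 ⟨hne, hs⟩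
  have hratio : ∀ s' ∈ T.erase i, θt s / θ s = θt s' / θ s' := fun s' hs' => by
    have h1 := (hθ s).ne'
    have h2 := (hθ s').ne'
    rw [hts s hse, hts s' hs']
    field_simp
  have hθe : ∑ x ∈ T.erase i, θ x = 1 - θ i := by
    linarith [Finset.add_sum_erase T θ hi]
  have hbe : ∑ x ∈ T.erase i, θb x = 1 - t := by
    linarith [Finset.add_sum_erase T θb hi]
  have hte : ∑ x ∈ T.erase i, θt x = 1 - t := by
    rw [Finset.sum_congr rfl hts, ← Finset.sum_div, ← Finset.sum_mul, hθe]
    field_simp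
  constructor
  · obtain ⟨s', hs', h⟩ := Finset.exists_le_of_sum_le ⟨s, hse⟩ (hbe.trans hte.symm).le
    refine ⟨s', Finset.mem_of_mem_erase hs', ?_⟩
    rw [hratio s' hs']
    exact div_le_div_of_nonneg_right h (hθ s').le
  · obtain ⟨s', hs', h⟩ := Finset.exists_le_of_sum_le ⟨s, hse⟩ (hte.trans hbe.symm).le
    refine ⟨s', Finset.mem_of_mem_erase hs', ?_⟩
    rw [hratio s' hs']
    exact div_le_div_of_nonneg_right h (hθ s').le

/-- The logarithmic range of a positive family `f` is at most that of a positive family `g`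
if every value of `f` lies between two values of `g`. -/
theorem log_sup'_sub_log_inf'_le {Y : Type*} [Fintype Y] [Nonempty Y] {f g : Y → ℝ}
    (hf : ∀ y, 0 < f y) (hg : ∀ y, 0 < g y)
    (h : ∀ y, (∃ z, g z ≤ f y) ∧ ∃ z, f y ≤ g z) :
    Real.log (Finset.univ.sup' Finset.univ_nonempty f) -
        Real.log (Finset.univ.inf' Finset.univ_nonempty f) ≤
      Real.log (Finset.univ.sup' Finset.univ_nonempty g) -
        Real.log (Finset.univ.inf' Finset.univ_nonempty g) := by
  refine sub_le_sub (Real.log_le_log ?_ ?_) (Real.log_le_log ?_ ?_)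
  · obtain ⟨y⟩ := ‹Nonempty Y›
    exact (hf y).trans_le (Finset.le_sup' f (Finset.mem_univ y))
  · refine Finset.sup'_le _ _ fun y _ => ?_
    obtain ⟨z, hz⟩ := (h y).2
    exact hz.trans (Finset.le_sup' g (Finset.mem_univ z))
  · exact (Finset.lt_inf'_iff _).2 fun y _ => hg y
  · refine Finset.le_inf' _ _ fun y _ => ?_
    obtain ⟨z, hz⟩ := (h y).1
    exact (Finset.inf'_le g (Finset.mem_univ z)).trans hz


/-- **Proportional covariation minimizes the Chan–Darwiche distance in single full
CPT analyses of multilinear models.**  Let `θ` be strictly positive and valid on every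
block with distinguished parameters `θ (ji j) ∈ (0,1)`, every block index occurring
in some monomial.  Fix target values `t j ∈ (0,1)` and let `θt` be the proportional
covariation.  Then for every strictly positive `θb` agreeing with `θ` outside the
blocks, valid on every block, and with `θb (ji j) = t j`, we have
`D_CD(p_θ, p_{θb}) ≥ D_CD(p_θ, p_{θt})`. -/
theorem stmt_7 {Y : Type} [Fintype Y] [Nonempty Y] {k n : ℕ}
    (S : Y → Finset (Fin k)) (Θ : Fin n → Finset (Fin k))
    (hdisj : ∀ j j' : Fin n, j ≠ j' → Disjoint (Θ j) (Θ j'))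
    (ji : Fin n → Fin k) (hji : ∀ j, ji j ∈ Θ j)
    (hcard : ∀ y : Y, (S y ∩ Finset.univ.biUnion Θ).card ≤ 1)
    (θ : Fin k → ℝ) (hθ : ∀ i, 0 < θ i)
    (hvalid : ∀ j, ∑ s ∈ Θ j, θ s = 1)
    (hocc : ∀ j, ∀ s ∈ Θ j, ∃ y : Y, s ∈ S y)
    (hθi : ∀ j, θ (ji j) ∈ Set.Ioo (0 : ℝ) 1)
    (t : Fin n → ℝ) (ht : ∀ j, t j ∈ Set.Ioo (0 : ℝ) 1)
    (θt : Fin k → ℝ) (hti : ∀ j, θt (ji j) = t j)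
    (hts : ∀ j, ∀ s ∈ (Θ j).erase (ji j),
      θt s = θ s * (1 - t j) / (1 - θ (ji j)))
    (htout : ∀ i, i ∉ Finset.univ.biUnion Θ → θt i = θ i)
    (θb : Fin k → ℝ) (hθb : ∀ i, 0 < θb i)
    (hbout : ∀ i, i ∉ Finset.univ.biUnion Θ → θb i = θ i)
    (hbi : ∀ j, θb (ji j) = t j)
    (hbvalid : ∀ j, ∑ s ∈ Θ j, θb s = 1) :
    Real.log (Finset.univ.sup' Finset.univ_nonempty
        (fun y : Y => (∏ l ∈ S y, θb l) / ∏ l ∈ S y, θ l)) -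
      Real.log (Finset.univ.inf' Finset.univ_nonempty
        (fun y : Y => (∏ l ∈ S y, θb l) / ∏ l ∈ S y, θ l)) ≥
    Real.log (Finset.univ.sup' Finset.univ_nonempty
        (fun y : Y => (∏ l ∈ S y, θt l) / ∏ l ∈ S y, θ l)) -
      Real.log (Finset.univ.inf' Finset.univ_nonempty
        (fun y : Y => (∏ l ∈ S y, θt l) / ∏ l ∈ S y, θ l)) := by
  have hmem : ∀ {j s}, s ∈ Θ j → s ∈ Finset.univ.biUnion Θ := fun {j s} hs =>
    Finset.mem_biUnion.2 ⟨j, Finset.mem_univ j, hs⟩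
  have hθt : ∀ i, 0 < θt i := by
    intro i
    by_cases hi : i ∈ Finset.univ.biUnion Θ
    · obtain ⟨j, -, hij⟩ := Finset.mem_biUnion.1 hi
      rcases eq_or_ne i (ji j) with rfl | hne
      · rw [hti j]
        exact (ht j).1
      · rw [hts j i (Finset.mem_erase.2 ⟨hne, hij⟩)]
        exact div_pos (mul_pos (hθ i) (sub_pos.2 (ht j).2)) (sub_pos.2 (hθi j).2)
    · rw [htout i hi]
      exact hθ i
  refine log_sup'_sub_log_inf'_le
    (fun y => div_pos (Finset.prod_pos fun i _ => hθt i) (Finset.prod_pos fun i _ => hθ i))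
    (fun y => div_pos (Finset.prod_pos fun i _ => hθb i) (Finset.prod_pos fun i _ => hθ i))
    fun y => ?_
  by_cases hy : ∃ s ∈ S y, s ∈ Finset.univ.biUnion Θ
  · obtain ⟨s, hsy, hsU⟩ := hy
    obtain ⟨j, -, hsj⟩ := Finset.mem_biUnion.1 hsU
    obtain ⟨⟨a, ha, hal⟩, b, hb, hbl⟩ := exists_div_le_and_exists_le_div (hji j) hθ (hvalid j)
      (hθi j).2 (hti j) (hts j) (hbi j) (hbvalid j) hsj
    obtain ⟨ya, hya⟩ := hocc j a ha
    obtain ⟨yb, hyb⟩ := hocc j b hb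
    refine ⟨⟨ya, ?_⟩, yb, ?_⟩
    · rwa [prod_div_prod_eq_div_of_mem_s7 hθ (hcard y) htout hsy hsU,
        prod_div_prod_eq_div_of_mem_s7 hθ (hcard ya) hbout hya (hmem ha)]
    · rwa [prod_div_prod_eq_div_of_mem_s7 hθ (hcard y) htout hsy hsU,
        prod_div_prod_eq_div_of_mem_s7 hθ (hcard yb) hbout hyb (hmem hb)]
  · push Not at hy
    have heq := (prod_div_prod_eq_one_of_forall_notMem hθ hbout hy).trans
      (prod_div_prod_eq_one_of_forall_notMem hθ htout hy).symm
    exact ⟨⟨y, heq.le⟩, y, heq.ge⟩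
end

section
/- In the multilinear single full CPT setting, let φ : (0,∞) → ℝ be convex with φ(1) = 0, suppose θ and θ̃ have strictly positive entries, θ̃ agrees with θ outside ⋃_j Θ_j, and for each block j there is a constant c_j such that Σ_{y∈𝕐 : s∈S(y)} ∏_{l∈S(y)∖{s}} θ_l = c_j for every s ∈ Θ_j. Then the φ-divergence satisfies D_φ(p_{θ̃}, p_θ) = Σ_{j=1}^n c_j Σ_{s∈Θ_j} θ_s φ(θ̃_s/θ_s); that is, it decomposes as a weighted sum over blocks of the φ-divergences between the varied and original block parameter vectors. -/
/-- If `A` meets `B` in at most one index and `θt` agrees with `θ` off `B`, the `φ`-divergence term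
of the monomial indexed by `A` is carried by the single index in `A ∩ B`, if any. -/
theorem prod_mul_phi_div_eq_sum_inter {ι : Type*} [DecidableEq ι] (A B : Finset ι)
    (hcard : (A ∩ B).card ≤ 1) (θ θt : ι → ℝ) (hθ : ∀ i, 0 < θ i)
    (hagree : ∀ i, i ∉ B → θt i = θ i) (φ : ℝ → ℝ) (hφ1 : φ 1 = 0) :
    (∏ l ∈ A, θ l) * φ ((∏ l ∈ A, θt l) / ∏ l ∈ A, θ l) =
      ∑ s ∈ A ∩ B, (∏ l ∈ A.erase s, θ l) * (θ s * φ (θt s / θ s)) := by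
  have hpos (C : Finset ι) : (∏ l ∈ C, θ l) ≠ 0 := (Finset.prod_pos fun i _ => hθ i).ne'
  rcases Nat.le_one_iff_eq_zero_or_eq_one.mp hcard with h | h
  · rw [Finset.card_eq_zero] at h
    have hprod : ∏ l ∈ A, θt l = ∏ l ∈ A, θ l :=
      Finset.prod_congr rfl fun l hl => hagree l fun hB =>
        Finset.notMem_empty l (h ▸ Finset.mem_inter.mpr ⟨hl, hB⟩)
    rw [h, hprod, div_self (hpos A), hφ1, mul_zero, Finset.sum_empty]
  · obtain ⟨s, hs⟩ := Finset.card_eq_one.mp h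
    have hsA : s ∈ A := (Finset.mem_inter.mp (hs ▸ Finset.mem_singleton_self s)).1
    have hprod : ∏ l ∈ A.erase s, θt l = ∏ l ∈ A.erase s, θ l :=
      Finset.prod_congr rfl fun l hl => hagree l fun hB =>
        Finset.ne_of_mem_erase hl <| Finset.mem_singleton.mp <|
          hs ▸ Finset.mem_inter.mpr ⟨Finset.mem_of_mem_erase hl, hB⟩
    rw [hs, Finset.sum_singleton, ← Finset.mul_prod_erase A θ hsA,
      ← Finset.mul_prod_erase A θt hsA, hprod, mul_div_mul_right _ _ (hpos _)]
    ring

/-- **Block decomposition of φ-divergences in multilinear single full CPT analyses.**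
Let `φ` be convex on `(0,∞)` with `φ 1 = 0`, let `θ, θt` be strictly positive with
`θt` agreeing with `θ` outside the blocks, and suppose that for each block `j` the
quantity `∑_{y : s ∈ S y} ∏_{l ∈ S y \ {s}} θ l` equals a constant `c j` for every
`s ∈ Θ j`.  Then
`D_φ(p_{θt}, p_θ) = ∑_j c j * ∑_{s ∈ Θ j} θ s * φ (θt s / θ s)`. -/
theorem stmt_8 {Y : Type} [Fintype Y] [Nonempty Y] {k n : ℕ}
    (S : Y → Finset (Fin k)) (Θ : Fin n → Finset (Fin k))
    (hdisj : ∀ j j' : Fin n, j ≠ j' → Disjoint (Θ j) (Θ j'))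
    (ji : Fin n → Fin k) (hji : ∀ j, ji j ∈ Θ j)
    (hcard : ∀ y : Y, (S y ∩ Finset.univ.biUnion Θ).card ≤ 1)
    (θ θt : Fin k → ℝ) (hθ : ∀ i, 0 < θ i) (hθt : ∀ i, 0 < θt i)
    (hagree : ∀ i, i ∉ Finset.univ.biUnion Θ → θt i = θ i)
    (φ : ℝ → ℝ) (hconv : ConvexOn ℝ (Set.Ioi 0) φ) (hφ1 : φ 1 = 0)
    (c : Fin n → ℝ)
    (hc : ∀ j, ∀ s ∈ Θ j,
      ∑ y ∈ Finset.univ.filter (fun y : Y => s ∈ S y),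
        ∏ l ∈ (S y).erase s, θ l = c j) :
    ∑ y : Y, (∏ l ∈ S y, θ l) * φ ((∏ l ∈ S y, θt l) / ∏ l ∈ S y, θ l) =
      ∑ j, c j * ∑ s ∈ Θ j, θ s * φ (θt s / θ s) := by
  calc
    _ = ∑ y, ∑ s ∈ S y ∩ Finset.univ.biUnion Θ,
          (∏ l ∈ (S y).erase s, θ l) * (θ s * φ (θt s / θ s)) :=
      Finset.sum_congr rfl fun y _ =>
        prod_mul_phi_div_eq_sum_inter _ _ (hcard y) θ θt hθ hagree φ hφ1
    _ = ∑ s ∈ Finset.univ.biUnion Θ, ∑ y ∈ Finset.univ.filter (fun y : Y => s ∈ S y),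
          (∏ l ∈ (S y).erase s, θ l) * (θ s * φ (θt s / θ s)) :=
      Finset.sum_comm' fun y s => by simp
    _ = ∑ j, ∑ s ∈ Θ j, ∑ y ∈ Finset.univ.filter (fun y : Y => s ∈ S y),
          (∏ l ∈ (S y).erase s, θ l) * (θ s * φ (θt s / θ s)) :=
      Finset.sum_biUnion fun j _ j' _ hne => hdisj j j' hne
    _ = _ := by
      refine Finset.sum_congr rfl fun j _ => ?_
      rw [Finset.mul_sum]
      refine Finset.sum_congr rfl fun s hs => ?_
      rw [← Finset.sum_mul, hc j s hs]
end

section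
/- Let φ : (0,∞) → ℝ be convex with φ(1) = 0, let r ≥ 2, let θ ∈ (0,1)^r with Σ_{s=1}^r θ_s = 1, fix i ∈ [r] and t ∈ (0,1), and define the proportional covariation θ̃ by θ̃_i = t and θ̃_s = θ_s(1−t)/(1−θ_i) for s ≠ i. Then for every θ̄ ∈ (0,1)^r with Σ_{s=1}^r θ̄_s = 1 and θ̄_i = t one has Σ_{s=1}^r θ_s φ(θ̄_s/θ_s) ≥ Σ_{s=1}^r θ_s φ(θ̃_s/θ_s) = θ_i φ(t/θ_i) + (1−θ_i) φ((1−t)/(1−θ_i)); that is, proportional covariation minimizes the φ-divergence from θ among all probability vectors with i-th coordinate t. -/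
/-- **Log-sum inequality** for a convex function on the positive reals. -/
theorem ConvexOn.sum_mul_map_div_le {ι : Type*} {φ : ℝ → ℝ} (hφ : ConvexOn ℝ (Set.Ioi 0) φ)
    {S : Finset ι} {w v : ι → ℝ} (hw : ∀ s ∈ S, 0 < w s) (hv : ∀ s ∈ S, 0 < v s)
    (hS : S.Nonempty) :
    (∑ s ∈ S, w s) * φ ((∑ s ∈ S, v s) / ∑ s ∈ S, w s) ≤ ∑ s ∈ S, w s * φ (v s / w s) := by
  have hW : 0 < ∑ s ∈ S, w s := Finset.sum_pos hw hS
  have h := hφ.map_centerMass_le (p := fun s => v s / w s) (fun s hs => (hw s hs).le) hW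
    (fun s hs => div_pos (hv s hs) (hw s hs))
  have hv' : ∑ s ∈ S, w s * (v s / w s) = ∑ s ∈ S, v s :=
    Finset.sum_congr rfl fun s hs => mul_div_cancel₀ _ (hw s hs).ne'
  simp only [Finset.centerMass, smul_eq_mul, Function.comp_apply, hv'] at h
  rwa [inv_mul_eq_div, inv_mul_eq_div, le_div_iff₀' hW] at h

/-- **Proportional covariation minimizes any φ-divergence for a single parameter
change.**  Let `φ` be convex on `(0,∞)` with `φ 1 = 0`, let `θ ∈ (0,1)^r` be a
probability vector, `i` a coordinate varied to `t ∈ (0,1)`, and `θt` the proportional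
covariation.  Then for every probability vector `θb ∈ (0,1)^r` with `θb i = t` we
have `∑ θ s * φ(θb s / θ s) ≥ ∑ θ s * φ(θt s / θ s)`, and the latter equals
`θ i * φ(t/θ i) + (1−θ i) * φ((1−t)/(1−θ i))`. -/
theorem stmt_9 (φ : ℝ → ℝ) (hconv : ConvexOn ℝ (Set.Ioi 0) φ) (hφ1 : φ 1 = 0)
    {r : ℕ} (hr : 2 ≤ r) (θ : Fin r → ℝ)
    (hθ : ∀ s, θ s ∈ Set.Ioo (0 : ℝ) 1) (hsum : ∑ s, θ s = 1)
    (i : Fin r) (t : ℝ) (ht : t ∈ Set.Ioo (0 : ℝ) 1)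
    (θt : Fin r → ℝ) (hti : θt i = t)
    (hts : ∀ s, s ≠ i → θt s = θ s * (1 - t) / (1 - θ i))
    (θb : Fin r → ℝ) (hθb : ∀ s, θb s ∈ Set.Ioo (0 : ℝ) 1)
    (hsumb : ∑ s, θb s = 1) (hbi : θb i = t) :
    (∑ s, θ s * φ (θb s / θ s) ≥ ∑ s, θ s * φ (θt s / θ s)) ∧
    (∑ s, θ s * φ (θt s / θ s) =
      θ i * φ (t / θ i) + (1 - θ i) * φ ((1 - t) / (1 - θ i))) := by
  have hi : 0 < 1 - θ i := sub_pos.2 (hθ i).2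
  have hθ_erase : ∑ s ∈ Finset.univ.erase i, θ s = 1 - θ i := by
    rw [Finset.sum_erase_eq_sub (Finset.mem_univ i), hsum]
  have hθb_erase : ∑ s ∈ Finset.univ.erase i, θb s = 1 - t := by
    rw [Finset.sum_erase_eq_sub (Finset.mem_univ i), hsumb, hbi]
  have heq : ∑ s, θ s * φ (θt s / θ s) =
      θ i * φ (t / θ i) + (1 - θ i) * φ ((1 - t) / (1 - θ i)) := by
    rw [← Finset.add_sum_erase _ _ (Finset.mem_univ i), hti, ← hθ_erase, Finset.sum_mul, hθ_erase]
    congr 1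
    refine Finset.sum_congr rfl fun s hs => ?_
    have hs0 : θ s ≠ 0 := (hθ s).1.ne'
    rw [hts s (Finset.ne_of_mem_erase hs), mul_div_assoc, mul_div_cancel_left₀ _ hs0]
  refine ⟨?_, heq⟩
  have hne : (Finset.univ.erase i).Nonempty := by
    refine Finset.nonempty_of_sum_ne_zero (f := θ) ?_
    rw [hθ_erase]
    exact hi.ne'
  have h := hconv.sum_mul_map_div_le (fun s _ => (hθ s).1) (fun s _ => (hθb s).1) hne
  rw [hθ_erase, hθb_erase] at h
  rw [heq, ge_iff_le, ← Finset.add_sum_erase _ _ (Finset.mem_univ i), hbi]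
  exact add_le_add_right h _
end

section
/- In the multilinear single full CPT setting, let φ : (0,∞) → ℝ be convex with φ(1) = 0, suppose θ has strictly positive entries, is valid (Σ_{s∈Θ_j} θ_s = 1 for every j) with each θ_{j_i} ∈ (0,1), and for each block j the constant c_j := Σ_{y∈𝕐 : s∈S(y)} ∏_{l∈S(y)∖{s}} θ_l is the same for every s ∈ Θ_j and is strictly positive. Fix target values t_j ∈ (0,1) and let θ̃ be the proportional covariation: θ̃_{j_i} = t_j and θ̃_s = θ_s(1−t_j)/(1−θ_{j_i}) for s ∈ Θ_j∖{j_i}. Then for every θ̄ with strictly positive entries agreeing with θ outside ⋃_j Θ_j, valid on every block, and with θ̄_{j_i} = t_j for every j, one has D_φ(p_{θ̄}, p_θ) ≥ D_φ(p_{θ̃}, p_θ); that is, proportional covariation minimizes every φ-divergence in single full CPT analyses of multilinear models. -/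
/-- A `φ`-divergence term of an atom whose monomial meets the varied set `B` at most once. -/
theorem mul_map_prod_div_prod_eq_sum {k : ℕ} {A B : Finset (Fin k)} (hcard : (A ∩ B).card ≤ 1)
    {φ : ℝ → ℝ} (hφ1 : φ 1 = 0) {θ θ' : Fin k → ℝ} (hθ : ∀ i, 0 < θ i)
    (hout : ∀ i, i ∉ B → θ' i = θ i) :
    (∏ l ∈ A, θ l) * φ ((∏ l ∈ A, θ' l) / ∏ l ∈ A, θ l) =
      ∑ s ∈ B, if s ∈ A then (∏ l ∈ A.erase s, θ l) * (θ s * φ (θ' s / θ s)) else 0 := by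
  rw [← Finset.sum_filter, Finset.filter_mem_eq_inter, Finset.inter_comm]
  rcases Nat.le_one_iff_eq_zero_or_eq_one.mp hcard with h | h
  · rw [Finset.card_eq_zero] at h
    have hprod : ∏ l ∈ A, θ' l = ∏ l ∈ A, θ l := Finset.prod_congr rfl fun l hl =>
      hout l fun hlB => by simpa [h] using Finset.mem_inter.mpr ⟨hl, hlB⟩
    rw [h, hprod, div_self (Finset.prod_pos fun i _ => hθ i).ne', hφ1]
    simp
  · obtain ⟨a, h⟩ := Finset.card_eq_one.mp h
    have haA : a ∈ A := (Finset.mem_inter.mp (h ▸ Finset.mem_singleton_self a)).1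
    have hprod : ∏ l ∈ A.erase a, θ' l = ∏ l ∈ A.erase a, θ l :=
      Finset.prod_congr rfl fun l hl => hout l fun hlB => by
        have : l ∈ A ∩ B := Finset.mem_inter.mpr ⟨Finset.mem_of_mem_erase hl, hlB⟩
        rw [h, Finset.mem_singleton] at this
        exact Finset.ne_of_mem_erase hl this
    have hpos : (∏ l ∈ A.erase a, θ l) ≠ 0 := (Finset.prod_pos fun i _ => hθ i).ne'
    rw [h, Finset.sum_singleton, ← Finset.mul_prod_erase A θ haA,
      ← Finset.mul_prod_erase A θ' haA, hprod, mul_div_mul_right _ _ hpos]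
    ring

/-- The `φ`-divergence of a single full CPT variation is a weighted sum of the divergences of
the blocks. -/
theorem sum_mul_map_prod_div_prod_eq {Y : Type} [Fintype Y] {k n : ℕ}
    {S : Y → Finset (Fin k)} {Θ : Fin n → Finset (Fin k)}
    (hdisj : ∀ j j' : Fin n, j ≠ j' → Disjoint (Θ j) (Θ j'))
    (hcard : ∀ y : Y, (S y ∩ Finset.univ.biUnion Θ).card ≤ 1)
    {φ : ℝ → ℝ} (hφ1 : φ 1 = 0) {θ θ' : Fin k → ℝ} (hθ : ∀ i, 0 < θ i)
    {c : Fin n → ℝ}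
    (hc : ∀ j, ∀ s ∈ Θ j,
      ∑ y ∈ Finset.univ.filter (fun y : Y => s ∈ S y),
        ∏ l ∈ (S y).erase s, θ l = c j)
    (hout : ∀ i, i ∉ Finset.univ.biUnion Θ → θ' i = θ i) :
    ∑ y : Y, (∏ l ∈ S y, θ l) * φ ((∏ l ∈ S y, θ' l) / ∏ l ∈ S y, θ l) =
      ∑ j, c j * ∑ s ∈ Θ j, θ s * φ (θ' s / θ s) := by
  simp_rw [fun y => mul_map_prod_div_prod_eq_sum (hcard y) hφ1 hθ hout]
  rw [Finset.sum_comm, Finset.sum_biUnion fun j _ j' _ hjj' => hdisj j j' hjj']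
  refine Finset.sum_congr rfl fun j _ => ?_
  rw [Finset.mul_sum]
  refine Finset.sum_congr rfl fun s hs => ?_
  rw [← Finset.sum_filter, ← Finset.sum_mul, hc j s hs]

/-- The log-sum form of Jensen's inequality for a convex function on `(0, ∞)`. -/
theorem ConvexOn.sum_mul_map_div_le_s10 {ι : Type*} {φ : ℝ → ℝ}
    (hconv : ConvexOn ℝ (Set.Ioi 0) φ) {A : Finset ι} {p q : ι → ℝ}
    (hp : ∀ i ∈ A, 0 < p i) (hq : ∀ i ∈ A, 0 < q i) :
    (∑ i ∈ A, p i) * φ ((∑ i ∈ A, q i) / ∑ i ∈ A, p i) ≤ ∑ i ∈ A, p i * φ (q i / p i) := by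
  rcases A.eq_empty_or_nonempty with rfl | hA
  · simp
  have hP : 0 < ∑ i ∈ A, p i := Finset.sum_pos hp hA
  have h := hconv.map_sum_le (t := A) (w := fun i => p i / ∑ i ∈ A, p i)
    (p := fun i => q i / p i) (fun i hi => (div_pos (hp i hi) hP).le)
    (by rw [← Finset.sum_div, div_self hP.ne']) fun i hi => div_pos (hq i hi) (hp i hi)
  have hmean : ∑ i ∈ A, (p i / ∑ i ∈ A, p i) • (q i / p i) = (∑ i ∈ A, q i) / ∑ i ∈ A, p i := by
    rw [Finset.sum_div]
    refine Finset.sum_congr rfl fun i hi => ?_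
    have := (hp i hi).ne'
    rw [smul_eq_mul]
    field_simp
  rw [hmean] at h
  calc _ ≤ _ := mul_le_mul_of_nonneg_left h hP.le
    _ = _ := by
      rw [Finset.mul_sum]
      refine Finset.sum_congr rfl fun i _ => ?_
      rw [smul_eq_mul]
      field_simp


/-- **Proportional covariation minimizes every φ-divergence in single full CPT
analyses of multilinear models.**  Let `φ` be convex on `(0,∞)` with `φ 1 = 0`, let
`θ` be strictly positive and valid on every block with `θ (ji j) ∈ (0,1)`, and suppose
for each block `j` the quantity `∑_{y : s ∈ S y} ∏_{l ∈ S y \ {s}} θ l` equals a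
strictly positive constant `c j` for every `s ∈ Θ j`.  Let `θt` be the proportional
covariation to target values `t j ∈ (0,1)`.  Then for every strictly positive `θb`
agreeing with `θ` outside the blocks, valid on every block, and with `θb (ji j) = t j`,
we have `D_φ(p_{θb}, p_θ) ≥ D_φ(p_{θt}, p_θ)`. -/
theorem stmt_10 {Y : Type} [Fintype Y] [Nonempty Y] {k n : ℕ}
    (S : Y → Finset (Fin k)) (Θ : Fin n → Finset (Fin k))
    (hdisj : ∀ j j' : Fin n, j ≠ j' → Disjoint (Θ j) (Θ j'))
    (ji : Fin n → Fin k) (hji : ∀ j, ji j ∈ Θ j)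
    (hcard : ∀ y : Y, (S y ∩ Finset.univ.biUnion Θ).card ≤ 1)
    (φ : ℝ → ℝ) (hconv : ConvexOn ℝ (Set.Ioi 0) φ) (hφ1 : φ 1 = 0)
    (θ : Fin k → ℝ) (hθ : ∀ i, 0 < θ i)
    (hvalid : ∀ j, ∑ s ∈ Θ j, θ s = 1)
    (hθi : ∀ j, θ (ji j) ∈ Set.Ioo (0 : ℝ) 1)
    (c : Fin n → ℝ) (hcpos : ∀ j, 0 < c j)
    (hc : ∀ j, ∀ s ∈ Θ j,
      ∑ y ∈ Finset.univ.filter (fun y : Y => s ∈ S y),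
        ∏ l ∈ (S y).erase s, θ l = c j)
    (t : Fin n → ℝ) (ht : ∀ j, t j ∈ Set.Ioo (0 : ℝ) 1)
    (θt : Fin k → ℝ) (hti : ∀ j, θt (ji j) = t j)
    (hts : ∀ j, ∀ s ∈ (Θ j).erase (ji j),
      θt s = θ s * (1 - t j) / (1 - θ (ji j)))
    (htout : ∀ i, i ∉ Finset.univ.biUnion Θ → θt i = θ i)
    (θb : Fin k → ℝ) (hθb : ∀ i, 0 < θb i)
    (hbout : ∀ i, i ∉ Finset.univ.biUnion Θ → θb i = θ i)
    (hbi : ∀ j, θb (ji j) = t j)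
    (hbvalid : ∀ j, ∑ s ∈ Θ j, θb s = 1) :
    ∑ y : Y, (∏ l ∈ S y, θ l) * φ ((∏ l ∈ S y, θb l) / ∏ l ∈ S y, θ l) ≥
      ∑ y : Y, (∏ l ∈ S y, θ l) * φ ((∏ l ∈ S y, θt l) / ∏ l ∈ S y, θ l) := by
  rw [ge_iff_le, sum_mul_map_prod_div_prod_eq hdisj hcard hφ1 hθ hc htout,
    sum_mul_map_prod_div_prod_eq hdisj hcard hφ1 hθ hc hbout]
  refine Finset.sum_le_sum fun j _ => mul_le_mul_of_nonneg_left ?_ (hcpos j).le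
  have hp : ∑ s ∈ (Θ j).erase (ji j), θ s = 1 - θ (ji j) := by
    rw [← hvalid j, ← Finset.add_sum_erase _ _ (hji j)]
    ring
  have hq : ∑ s ∈ (Θ j).erase (ji j), θb s = 1 - t j := by
    rw [← hbvalid j, ← Finset.add_sum_erase _ _ (hji j), hbi]
    ring
  rw [← Finset.add_sum_erase _ _ (hji j), ← Finset.add_sum_erase _ _ (hji j), hti, hbi]
  refine add_le_add_right ?_ _
  calc ∑ s ∈ (Θ j).erase (ji j), θ s * φ (θt s / θ s)
      = ∑ s ∈ (Θ j).erase (ji j), θ s * φ ((1 - t j) / (1 - θ (ji j))) := by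
        refine Finset.sum_congr rfl fun s hs => ?_
        rw [hts j s hs, mul_div_assoc, mul_div_cancel_left₀ _ (hθ s).ne']
    _ ≤ _ := by
        rw [← Finset.sum_mul, ← hq, hp, ← hp]
        exact hconv.sum_mul_map_div_le_s10 (fun i _ => hθ i) fun i _ => hθb i
end

section
/- Consider a monomial parametrisation with exponent vectors α(y) ∈ ℕ^k and two parameter vectors θ, θ̃ with strictly positive entries such that θ̃_j = θ_j for all j outside a subset C ⊆ {1,…,k}. Then the Chan–Darwiche distance satisfies D_CD(p_θ, p_{θ̃}) = log max_{y∈𝕐} ∏_{j∈C} (θ̃_j/θ_j)^{α_j(y)} − log min_{y∈𝕐} ∏_{j∈C} (θ̃_j/θ_j)^{α_j(y)}; in particular, the distance depends only on the exponents of the varied and covaried indeterminates and not on the values of the unvaried parameters. -/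
/-- The ratio of two monomials whose parameters agree outside `C` is the monomial over `C` in
the ratios of the parameters. -/
theorem prod_pow_div_prod_pow_eq_prod_subset {ι : Type*} [Fintype ι] (a : ι → ℕ) {θ θt : ι → ℝ}
    (hθ : ∀ j, 0 < θ j) {C : Finset ι} (hagree : ∀ j, j ∉ C → θt j = θ j) :
    (∏ j, θt j ^ a j) / ∏ j, θ j ^ a j = ∏ j ∈ C, (θt j / θ j) ^ a j := by
  simp only [← Finset.prod_div_distrib, ← div_pow]
  refine (Finset.prod_subset C.subset_univ fun j _ hj => ?_).symm
  rw [hagree j hj, div_self (hθ j).ne', one_pow]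

/-- **The Chan–Darwiche distance in a monomial parametrisation depends only on the
varied and covaried indeterminates.**  If `θ` and `θt` are strictly positive and agree
outside a subset `C` of the indeterminates, then
`D_CD(p_θ, p_{θt}) = log max_y ∏_{j∈C} (θt j / θ j)^{α y j}
  − log min_y ∏_{j∈C} (θt j / θ j)^{α y j}`. -/
theorem stmt_12 {Y : Type} [Fintype Y] [Nonempty Y] {k : ℕ}
    (α : Y → Fin k → ℕ) (θ θt : Fin k → ℝ)
    (hθ : ∀ j, 0 < θ j) (hθt : ∀ j, 0 < θt j)
    (C : Finset (Fin k)) (hagree : ∀ j, j ∉ C → θt j = θ j) :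
    Real.log (Finset.univ.sup' Finset.univ_nonempty
        (fun y : Y => (∏ j, θt j ^ α y j) / ∏ j, θ j ^ α y j)) -
      Real.log (Finset.univ.inf' Finset.univ_nonempty
        (fun y : Y => (∏ j, θt j ^ α y j) / ∏ j, θ j ^ α y j)) =
    Real.log (Finset.univ.sup' Finset.univ_nonempty
        (fun y : Y => ∏ j ∈ C, (θt j / θ j) ^ α y j)) -
      Real.log (Finset.univ.inf' Finset.univ_nonempty
        (fun y : Y => ∏ j ∈ C, (θt j / θ j) ^ α y j)) := by
  simp only [prod_pow_div_prod_pow_eq_prod_subset _ hθ hagree]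
end

section
/- Consider a monomial parametrisation with exponent vectors α(y) ∈ ℕ^k, a block C ⊆ {1,…,k} with Σ_{j∈C} θ_j = 1, all θ_j > 0, and i ∈ C with θ_i ∈ (0,1). Let θ̃ be the proportional covariation: θ̃_i = t ∈ (0,1), θ̃_j = θ_j(1−t)/(1−θ_i) for j ∈ C∖{i}, and θ̃_j = θ_j for j ∉ C. Then the Chan–Darwiche distance satisfies D_CD(p_θ, p_{θ̃}) = log max_{y∈𝕐} (t/θ_i)^{α_i(y)} ((1−t)/(1−θ_i))^{|α_{−i}(y)|} − log min_{y∈𝕐} (t/θ_i)^{α_i(y)} ((1−t)/(1−θ_i))^{|α_{−i}(y)|}, where |α_{−i}(y)| = Σ_{j∈C∖{i}} α_j(y). -/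
/-- Ratio of two monomials with the same exponents, when the parameters change by a factor `r` at
`i`, by a common factor `c` on the rest of a block `C`, and not at all outside `C`. -/
theorem prod_pow_div_prod_pow_of_block {ι K : Type*} [Fintype ι] [DecidableEq ι] [Field K]
    (a : ι → ℕ) (θ θt : ι → K) (hθ : ∀ j, θ j ≠ 0) {C : Finset ι} {i : ι} (hi : i ∈ C) (r c : K)
    (hr : θt i / θ i = r) (hc : ∀ j ∈ C.erase i, θt j / θ j = c)
    (hout : ∀ j, j ∉ C → θt j = θ j) :
    (∏ j, θt j ^ a j) / ∏ j, θ j ^ a j = r ^ a i * c ^ ∑ j ∈ C.erase i, a j := by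
  have hone : ∀ j ∈ Finset.univ, j ∉ C → (θt j / θ j) ^ a j = 1 := fun j _ hj => by
    rw [hout j hj, div_self (hθ j), one_pow]
  simp only [← Finset.prod_div_distrib, ← div_pow]
  rw [← Finset.prod_subset (Finset.subset_univ C) hone, ← Finset.mul_prod_erase C _ hi, hr,
    ← Finset.prod_pow_eq_pow_sum]
  exact congrArg _ (Finset.prod_congr rfl fun j hj => by rw [hc j hj])

/-- **Closed form of the Chan–Darwiche distance under proportional covariation in a
monomial parametrisation.**  Let `θ` be strictly positive with `∑_{j∈C} θ j = 1` and
`θ i ∈ (0,1)` for the distinguished index `i ∈ C`, and let `θt` be the proportional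
covariation: `θt i = t ∈ (0,1)`, `θt j = θ j (1−t)/(1−θ i)` for `j ∈ C \ {i}`, and
`θt j = θ j` outside `C`.  Then
`D_CD(p_θ, p_{θt}) = log max_y (t/θ i)^{α y i} ((1−t)/(1−θ i))^{|α_{−i}(y)|}
  − log min_y (t/θ i)^{α y i} ((1−t)/(1−θ i))^{|α_{−i}(y)|}`,
where `|α_{−i}(y)| = ∑_{j ∈ C \ {i}} α y j`. -/
theorem stmt_13 {Y : Type} [Fintype Y] [Nonempty Y] {k : ℕ}
    (α : Y → Fin k → ℕ) (θ : Fin k → ℝ) (hθ : ∀ j, 0 < θ j)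
    (C : Finset (Fin k)) (hsum : ∑ j ∈ C, θ j = 1)
    (i : Fin k) (hi : i ∈ C) (hθi : θ i ∈ Set.Ioo (0 : ℝ) 1)
    (t : ℝ) (ht : t ∈ Set.Ioo (0 : ℝ) 1)
    (θt : Fin k → ℝ) (hti : θt i = t)
    (htC : ∀ j ∈ C.erase i, θt j = θ j * (1 - t) / (1 - θ i))
    (htout : ∀ j, j ∉ C → θt j = θ j) :
    Real.log (Finset.univ.sup' Finset.univ_nonempty
        (fun y : Y => (∏ j, θt j ^ α y j) / ∏ j, θ j ^ α y j)) -
      Real.log (Finset.univ.inf' Finset.univ_nonempty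
        (fun y : Y => (∏ j, θt j ^ α y j) / ∏ j, θ j ^ α y j)) =
    Real.log (Finset.univ.sup' Finset.univ_nonempty
        (fun y : Y => (t / θ i) ^ α y i *
          ((1 - t) / (1 - θ i)) ^ ∑ j ∈ C.erase i, α y j)) -
      Real.log (Finset.univ.inf' Finset.univ_nonempty
        (fun y : Y => (t / θ i) ^ α y i *
          ((1 - t) / (1 - θ i)) ^ ∑ j ∈ C.erase i, α y j)) := by
  have hratio : ∀ y, (∏ j, θt j ^ α y j) / ∏ j, θ j ^ α y j =
      (t / θ i) ^ α y i * ((1 - t) / (1 - θ i)) ^ ∑ j ∈ C.erase i, α y j := fun y =>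
    prod_pow_div_prod_pow_of_block (α y) θ θt (fun j => (hθ j).ne') hi _ _ (by rw [hti])
      (fun j hj => by rw [htC j hj, mul_div_assoc, mul_div_cancel_left₀ _ (hθ j).ne']) htout
  simp only [hratio]
end
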